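/- Let B_s be an m×m real symmetric positive-definite matrix and B_r an n×n real symmetric positive-definite matrix with m ≥ n. Then there exists a matrix U ∈ ℝ^{m×n} with orthonormal columns (UᵀU = Iₙ) and Uᵀ B_s U = B_r if and only if the eigenvalues λ^{(r)}_1 ≤ … ≤ λ^{(r)}_n of B_r interlace the eigenvalues λ^{(s)}_1 ≤ … ≤ λ^{(s)}_m of B_s, i.e., λ^{(s)}_i ≤ λ^{(r)}_i ≤ λ^{(s)}_{i+m−n} for i = 1, …, n. (This is the generalized Cauchy interlacing theorem, including the converse of the classical Cauchy interlacing theorem.) -/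

import Mathlib

open Matrix

/-- `lam` is the increasing (with multiplicity) sequence of eigenvalues of the real
symmetric matrix `B`: there is an orthogonal matrix diagonalizing `B` to `diagonal lam`. -/
def IsSortedEigs {k : ℕ} (B : Matrix (Fin k) (Fin k) ℝ) (lam : Fin k → ℝ) : Prop :=
  Monotone lam ∧
    ∃ Q : Matrix (Fin k) (Fin k) ℝ, Qᵀ * Q = 1 ∧ Qᵀ * B * Q = Matrix.diagonal lam

/-- Lagrange weights for strictly interlacing nodes: positive `w` with `∑ i, w i / (a i - b j) = 0`
for every `j`. -/
lemma exists_pos_weights_of_strict_interlace {k : ℕ} (a : Fin (k + 1) → ℝ) (b : Fin k → ℝ)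
    (h₁ : ∀ j : Fin k, a j.castSucc < b j) (h₂ : ∀ j : Fin k, b j < a j.succ) :
    (∀ i j, a i - b j ≠ 0) ∧
      ∃ w : Fin (k + 1) → ℝ, (∀ i, 0 < w i) ∧ ∀ j, ∑ i, w i / (a i - b j) = 0 := by
  have ha : StrictMono a := Fin.strictMono_iff_lt_succ.2 fun j => (h₁ j).trans (h₂ j)
  have key : ∀ (i : Fin (k + 1)) (j : Fin k),
      0 < (a i - b j) / (a i - a (i.succAbove j)) := by
    intro i j
    rcases lt_or_ge j.castSucc i with hij | hij
    · rw [Fin.succAbove_of_castSucc_lt _ _ hij]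
      have : a j.succ ≤ a i := ha.monotone (Fin.castSucc_lt_iff_succ_le.1 hij)
      exact div_pos (by linarith [h₂ j]) (by linarith [ha hij])
    · rw [Fin.succAbove_of_le_castSucc _ _ hij]
      have : a i ≤ a j.castSucc := ha.monotone hij
      exact div_pos_of_neg_of_neg (by linarith [h₁ j]) (by linarith [h₁ j, h₂ j])
  have hne : ∀ i j, a i - b j ≠ 0 := fun i j h => by simpa [h] using key i j
  refine ⟨hne, fun i => ∏ j, (a i - b j) / (a i - a (i.succAbove j)),
    fun i => Finset.prod_pos fun j _ => key i j, fun j => ?_⟩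
  set P : Polynomial ℝ := ∏ l ∈ Finset.univ.erase j, (Polynomial.X - Polynomial.C (b l)) with hP
  have hdeg : P.natDegree < k := by
    rw [hP, Polynomial.natDegree_prod_of_monic _ _ fun l _ => Polynomial.monic_X_sub_C _]
    have := j.pos
    simp
    omega
  have hsum := Lagrange.coeff_eq_sum (s := Finset.univ) (v := a) ha.injective.injOn (P := P)
    (Polynomial.degree_le_natDegree.trans_lt (by
      rw [Finset.card_univ, Fintype.card_fin]
      exact_mod_cast hdeg.trans k.lt_succ_self))
  rw [Polynomial.coeff_eq_zero_of_natDegree_lt (by simpa using hdeg)] at hsum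
  rw [hsum]
  refine Finset.sum_congr rfl fun i _ => ?_
  have hden : ∏ l ∈ Finset.univ.erase i, (a i - a l) = ∏ l, (a i - a (i.succAbove l)) := by
    rw [← Finset.prod_image (f := fun l => a i - a l) i.succAbove_right_injective.injOn,
      Fin.image_succAbove_univ, Finset.compl_singleton]
  dsimp only
  rw [Finset.prod_div_distrib, hden, hP, Polynomial.eval_prod,
    ← Finset.mul_prod_erase Finset.univ (fun l => a i - b l) (Finset.mem_univ j)]
  simp only [Polynomial.eval_sub, Polynomial.eval_X, Polynomial.eval_C]
  have := hne i j
  field_simp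

lemma exists_compression_of_strict_interlace {k : ℕ} (a : Fin (k + 1) → ℝ) (b : Fin k → ℝ)
    (h₁ : ∀ j : Fin k, a j.castSucc < b j) (h₂ : ∀ j : Fin k, b j < a j.succ) :
    ∃ U : Matrix (Fin (k + 1)) (Fin k) ℝ, Uᵀ * U = 1 ∧ Uᵀ * diagonal a * U = diagonal b := by
  obtain ⟨hne, w, hw, hsum⟩ := exists_pos_weights_of_strict_interlace a b h₁ h₂
  have hb : StrictMono b := fun i j hij =>
    (h₂ i).trans_le (((Fin.strictMono_iff_lt_succ.2 fun j => (h₁ j).trans (h₂ j)).monotone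
      (by simpa [Fin.le_def] using hij)).trans (h₁ j).le)
  set N : Fin k → ℝ := fun j => ∑ i, w i / (a i - b j) ^ 2 with hN
  have hNpos : ∀ j, 0 < N j := fun j =>
    Finset.sum_pos (fun i _ => div_pos (hw i) (by have := hne i j; positivity)) Finset.univ_nonempty
  have hoff : ∀ j l, j ≠ l → ∑ i, w i / ((a i - b j) * (a i - b l)) = 0 := by
    intro j l hjl
    have hbjl : b j - b l ≠ 0 := sub_ne_zero.2 (hb.injective.ne hjl)
    have : ∑ i, w i / ((a i - b j) * (a i - b l)) =
        (∑ i, w i / (a i - b j) - ∑ i, w i / (a i - b l)) / (b j - b l) := by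
      rw [← Finset.sum_sub_distrib, Finset.sum_div]
      refine Finset.sum_congr rfl fun i _ => ?_
      have := hne i j
      have := hne i l
      field_simp
      ring
    rw [this, hsum, hsum]
    simp
  set U : Matrix (Fin (k + 1)) (Fin k) ℝ :=
    Matrix.of fun i j => √(w i) / (a i - b j) / √(N j) with hU
  have horth : Uᵀ * U = 1 := by
    ext j l
    have : (Uᵀ * U) j l = (∑ i, w i / ((a i - b j) * (a i - b l))) / (√(N j) * √(N l)) := by
      rw [Matrix.mul_apply, Finset.sum_div]
      refine Finset.sum_congr rfl fun i _ => ?_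
      simp only [hU, Matrix.transpose_apply, Matrix.of_apply]
      nth_rewrite 3 [← Real.mul_self_sqrt (hw i).le]
      rw [div_div, div_div, div_mul_div_comm, div_div]
      congr 1
      ring
    rw [this]
    rcases eq_or_ne j l with rfl | hjl
    · rw [Real.mul_self_sqrt (hNpos j).le, Matrix.one_apply_eq]
      simp only [← sq]
      exact div_self (hNpos j).ne'
    · rw [hoff j l hjl, Matrix.one_apply_ne hjl, zero_div]
  refine ⟨U, horth, ?_⟩
  have hshift : Uᵀ * (diagonal a * U - U * diagonal b) = 0 := by
    ext j l
    have : (Uᵀ * (diagonal a * U - U * diagonal b)) j l =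
        (∑ i, w i / (a i - b j)) / (√(N j) * √(N l)) := by
      rw [Matrix.mul_apply, Finset.sum_div]
      refine Finset.sum_congr rfl fun i _ => ?_
      simp only [hU, Matrix.transpose_apply, Matrix.of_apply, Matrix.sub_apply,
        Matrix.diagonal_mul, Matrix.mul_diagonal]
      nth_rewrite 4 [← Real.mul_self_sqrt (hw i).le]
      have := hne i j
      have := hne i l
      have := (Real.sqrt_pos.2 (hNpos j)).ne'
      have := (Real.sqrt_pos.2 (hNpos l)).ne'
      field_simp
    rw [this, hsum, zero_div, Matrix.zero_apply]
  rw [Matrix.mul_sub, sub_eq_zero, ← Matrix.mul_assoc, ← Matrix.mul_assoc, horth,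
    Matrix.one_mul] at hshift
  exact hshift

lemma isCompact_setOf_transpose_mul_self_eq_one (m n : ℕ) :
    IsCompact {U : Matrix (Fin m) (Fin n) ℝ | Uᵀ * U = 1} := by
  have hcpt : IsCompact (Set.univ.pi fun _ : Fin m => Set.univ.pi fun _ : Fin n =>
      Set.Icc (-1 : ℝ) 1) :=
    isCompact_univ_pi fun _ => isCompact_univ_pi fun _ => isCompact_Icc
  refine IsCompact.of_isClosed_subset (X := Fin m → Fin n → ℝ) hcpt
    (isClosed_eq (f := fun U : Matrix (Fin m) (Fin n) ℝ => Uᵀ * U) (by fun_prop)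
      continuous_const) ?_
  intro (U : Matrix (Fin m) (Fin n) ℝ) (hU : Uᵀ * U = 1) i _ j _
  have h : ∑ l, U l j * U l j = 1 := by
    have := congrFun (congrFun hU j) j
    simpa [Matrix.mul_apply] using this
  have hle : U i j * U i j ≤ 1 :=
    h ▸ Finset.single_le_sum (f := fun l => U l j * U l j) (fun l _ => mul_self_nonneg _)
      (Finset.mem_univ i)
  exact abs_le.1 (abs_le_one_iff_mul_self_le_one.2 hle)

lemma exists_compression_of_tendsto {m n : ℕ} {a' : ℕ → Fin m → ℝ} {b' : ℕ → Fin n → ℝ}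
    {a : Fin m → ℝ} {b : Fin n → ℝ} (ha : Filter.Tendsto a' Filter.atTop (nhds a))
    (hb : Filter.Tendsto b' Filter.atTop (nhds b))
    (h : ∀ N, ∃ U : Matrix (Fin m) (Fin n) ℝ, Uᵀ * U = 1 ∧
      Uᵀ * diagonal (a' N) * U = diagonal (b' N)) :
    ∃ U : Matrix (Fin m) (Fin n) ℝ, Uᵀ * U = 1 ∧ Uᵀ * diagonal a * U = diagonal b := by
  choose V hV hVab using h
  have : FirstCountableTopology (Matrix (Fin m) (Fin n) ℝ) :=
    inferInstanceAs (FirstCountableTopology (Fin m → Fin n → ℝ))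
  obtain ⟨U, hU, φ, hφ, hlim⟩ :=
    (isCompact_setOf_transpose_mul_self_eq_one m n).tendsto_subseq hV
  refine ⟨U, hU, ?_⟩
  have hcont : Continuous fun p : Matrix (Fin m) (Fin n) ℝ × (Fin m → ℝ) =>
      p.1ᵀ * diagonal p.2 * p.1 := by fun_prop
  have hl := (hcont.tendsto (U, a)).comp (hlim.prodMk_nhds (ha.comp hφ.tendsto_atTop))
  have hdiag : Continuous fun v : Fin n → ℝ => diagonal v := by fun_prop
  have hr := (hdiag.tendsto b).comp (hb.comp hφ.tendsto_atTop)
  exact tendsto_nhds_unique (hl.congr fun N => hVab (φ N)) hr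

lemma exists_compression_of_interlace_succ {k : ℕ} (a : Fin (k + 1) → ℝ) (b : Fin k → ℝ)
    (h₁ : ∀ j : Fin k, a j.castSucc ≤ b j) (h₂ : ∀ j : Fin k, b j ≤ a j.succ) :
    ∃ U : Matrix (Fin (k + 1)) (Fin k) ℝ, Uᵀ * U = 1 ∧ Uᵀ * diagonal a * U = diagonal b := by
  have hperturb : ∀ x c : ℝ, Filter.Tendsto (fun N : ℕ => x + c * (1 / ((N : ℝ) + 1)))
      Filter.atTop (nhds x) := fun x c => by
    simpa using (tendsto_one_div_add_atTop_nhds_zero_nat.const_mul c).const_add x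
  refine exists_compression_of_tendsto
    (a' := fun N i => a i + 2 * (i : ℝ) * (1 / ((N : ℝ) + 1)))
    (b' := fun N j => b j + (2 * (j : ℝ) + 1) * (1 / ((N : ℝ) + 1)))
    (tendsto_pi_nhds.2 fun i => hperturb _ _) (tendsto_pi_nhds.2 fun j => hperturb _ _)
    fun N => exists_compression_of_strict_interlace _ _ (fun j => ?_) fun j => ?_
  · have hpos : 0 < 1 / ((N : ℝ) + 1) := Nat.one_div_pos_of_nat
    simp only [Fin.val_castSucc]
    linarith [h₁ j]
  · have hpos : 0 < 1 / ((N : ℝ) + 1) := Nat.one_div_pos_of_nat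
    simp only [Fin.val_succ]
    push_cast
    linarith [h₂ j]

lemma exists_compression_of_interlace (n d : ℕ) (a b : ℕ → ℝ)
    (ha : ∀ i j, i ≤ j → j < n + d → a i ≤ a j) (hb : ∀ i j, i ≤ j → j < n → b i ≤ b j)
    (h : ∀ i < n, a i ≤ b i ∧ b i ≤ a (i + d)) :
    ∃ U : Matrix (Fin (n + d)) (Fin n) ℝ, Uᵀ * U = 1 ∧
      Uᵀ * diagonal (fun i : Fin (n + d) => a i) * U = diagonal (fun i : Fin n => b i) := by
  induction d generalizing a with
  | zero =>
    refine ⟨1, by simp, ?_⟩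
    simp only [Nat.add_zero, transpose_one, Matrix.one_mul, Matrix.mul_one]
    congr 1
    ext i
    exact le_antisymm (h i i.2).1 (h i i.2).2
  | succ d ih =>
    let c : ℕ → ℝ := fun i => if i < d then a i else max (a i) (b (i - d))
    have hac : ∀ i, a i ≤ c i := fun i => by
      simp only [c]; split_ifs <;> simp
    obtain ⟨V, hV, hVc⟩ := ih c
      (by
        intro i j hij hj
        have haij := ha i j hij (by omega)
        by_cases hi : i < d
        · simpa [c, hi] using haij.trans (hac j)
        · have hj' : ¬ j < d := by omega
          simpa [c, hi, hj'] using max_le_max haij (hb (i - d) (j - d) (by omega) (by omega)))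
      (by
        intro i hi
        refine ⟨?_, by simp [c]⟩
        simp only [c]
        split_ifs
        · exact (h i hi).1
        · exact max_le (h i hi).1 (hb _ _ (by omega) hi))
    obtain ⟨W, hW, hWa⟩ := exists_compression_of_interlace_succ (k := n + d)
      (fun i => a i) (fun i => c i) (fun j => hac j) (by
        intro j
        have hj := j.2
        have haj := ha j (j + 1) (by omega) (by omega)
        simp only [c, Fin.val_succ]
        split_ifs with hjd
        · exact haj
        · refine max_le haj ((h (j - d) (by omega)).2.trans_eq (congrArg a ?_))
          omega)
    refine ⟨W * V, ?_, ?_⟩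
    · rw [transpose_mul, Matrix.mul_assoc, ← Matrix.mul_assoc Wᵀ, hW, Matrix.one_mul, hV]
    · have : (W * V)ᵀ * diagonal (fun i : Fin (n + d + 1) => a i) * (W * V) =
          Vᵀ * (Wᵀ * diagonal (fun i : Fin (n + d + 1) => a i) * W) * V := by
        simp only [transpose_mul, Matrix.mul_assoc]
      exact this.trans (by rw [hWa, hVc])

/-- A dimension count: if `a` is at least `α` off `T`, `b` is at most `β` on `S`, and `S` is
larger than `T`, then a vector supported on `S` whose image vanishes on `T` gives `α ≤ β`. -/
lemma le_of_compression_of_card_lt {m n : ℕ} {a : Fin m → ℝ} {b : Fin n → ℝ}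
    {U : Matrix (Fin m) (Fin n) ℝ} (hU : Uᵀ * U = 1)
    (hab : Uᵀ * diagonal a * U = diagonal b) {S : Finset (Fin n)} {T : Finset (Fin m)}
    (hcard : T.card < S.card) {α β : ℝ} (hα : ∀ t ∉ T, α ≤ a t) (hβ : ∀ s ∈ S, b s ≤ β) :
    α ≤ β := by
  let L : (Fin n → ℝ) →ₗ[ℝ] ({j // j ∉ S} → ℝ) × (T → ℝ) :=
    (LinearMap.funLeft ℝ ℝ Subtype.val).prod
      ((LinearMap.funLeft ℝ ℝ Subtype.val).comp U.mulVecLin)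
  have hker : LinearMap.ker L ≠ ⊥ := by
    refine LinearMap.ker_ne_bot_of_finrank_lt ?_
    have : S.card ≤ n := by simpa using S.card_le_univ
    simp [Fintype.card_subtype_compl]
    omega
  obtain ⟨x, hx, hx0⟩ := Submodule.exists_mem_ne_zero_of_ne_bot hker
  rw [LinearMap.mem_ker, Prod.ext_iff] at hx
  have hxS : ∀ j ∉ S, x j = 0 := fun j hj => congrFun hx.1 ⟨j, hj⟩
  have hxT : ∀ t ∈ T, (U *ᵥ x) t = 0 := fun t ht => congrFun hx.2 ⟨t, ht⟩
  have hquad : ∀ A : Matrix (Fin m) (Fin m) ℝ,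
      (U *ᵥ x) ⬝ᵥ (A *ᵥ (U *ᵥ x)) = x ⬝ᵥ ((Uᵀ * A * U) *ᵥ x) := by
    intro A
    rw [← mulVec_mulVec, ← mulVec_mulVec, dotProduct_mulVec x Uᵀ, vecMul_transpose]
  have hnorm := hquad 1
  rw [Matrix.mul_one, hU, one_mulVec, one_mulVec] at hnorm
  have hform := hquad (diagonal a)
  rw [hab] at hform
  have hpos : 0 < x ⬝ᵥ x :=
    lt_of_le_of_ne (Finset.sum_nonneg fun i _ => mul_self_nonneg _)
      fun h => hx0 (dotProduct_self_eq_zero.1 h.symm)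
  have hlow : α * ((U *ᵥ x) ⬝ᵥ (U *ᵥ x)) ≤ (U *ᵥ x) ⬝ᵥ (diagonal a *ᵥ (U *ᵥ x)) := by
    simp only [dotProduct, Finset.mul_sum, mulVec_diagonal]
    refine Finset.sum_le_sum fun t _ => ?_
    by_cases ht : t ∈ T
    · simp [hxT t ht]
    · nlinarith [hα t ht, mul_self_nonneg ((U *ᵥ x) t)]
  have hupp : x ⬝ᵥ (diagonal b *ᵥ x) ≤ β * (x ⬝ᵥ x) := by
    simp only [dotProduct, Finset.mul_sum, mulVec_diagonal]
    refine Finset.sum_le_sum fun s _ => ?_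
    by_cases hs : s ∈ S
    · nlinarith [hβ s hs, mul_self_nonneg (x s)]
    · simp [hxS s hs]
  rw [hform, hnorm] at hlow
  exact le_of_mul_le_mul_right (hlow.trans hupp) hpos

/-- Conjugating by orthogonal matrices transports compressions. -/
lemma exists_compression_conj {m n : ℕ} {A A' : Matrix (Fin m) (Fin m) ℝ}
    {B B' : Matrix (Fin n) (Fin n) ℝ} {P : Matrix (Fin m) (Fin m) ℝ}
    {Q : Matrix (Fin n) (Fin n) ℝ} (hP : Pᵀ * P = 1) (hQ : Qᵀ * Q = 1)
    (hA : Pᵀ * A * P = A') (hB : Qᵀ * B * Q = B') :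
    (∃ U : Matrix (Fin m) (Fin n) ℝ, Uᵀ * U = 1 ∧ Uᵀ * A * U = B) ↔
      ∃ V : Matrix (Fin m) (Fin n) ℝ, Vᵀ * V = 1 ∧ Vᵀ * A' * V = B' := by
  have hP' := mul_eq_one_comm.1 hP
  have hQ' := mul_eq_one_comm.1 hQ
  constructor
  · rintro ⟨U, hU, hUA⟩
    refine ⟨Pᵀ * U * Q, ?_, ?_⟩
    · calc (Pᵀ * U * Q)ᵀ * (Pᵀ * U * Q) = Qᵀ * (Uᵀ * (P * Pᵀ) * U) * Q := by
            simp only [transpose_mul, transpose_transpose, Matrix.mul_assoc]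
        _ = 1 := by rw [hP', Matrix.mul_one, hU, Matrix.mul_one, hQ]
    · calc (Pᵀ * U * Q)ᵀ * A' * (Pᵀ * U * Q)
          = Qᵀ * (Uᵀ * ((P * Pᵀ) * A * (P * Pᵀ)) * U) * Q := by
            simp only [← hA, transpose_mul, transpose_transpose, Matrix.mul_assoc]
        _ = B' := by rw [hP', Matrix.mul_one, Matrix.one_mul, hUA, hB]
  · rintro ⟨V, hV, hVA⟩
    refine ⟨P * V * Qᵀ, ?_, ?_⟩
    · calc (P * V * Qᵀ)ᵀ * (P * V * Qᵀ) = Q * (Vᵀ * (Pᵀ * P) * V) * Qᵀ := by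
            simp only [transpose_mul, transpose_transpose, Matrix.mul_assoc]
        _ = 1 := by rw [hP, Matrix.mul_one, hV, Matrix.mul_one, hQ']
    · calc (P * V * Qᵀ)ᵀ * A * (P * V * Qᵀ) = Q * (Vᵀ * (Pᵀ * A * P) * V) * Qᵀ := by
            simp only [transpose_mul, transpose_transpose, Matrix.mul_assoc]
        _ = (Q * Qᵀ) * B * (Q * Qᵀ) := by
            rw [hA, hVA, ← hB]
            simp only [Matrix.mul_assoc]
        _ = B := by rw [hQ', Matrix.mul_one, Matrix.one_mul]

/-- Generalized Cauchy interlacing theorem (with converse): an orthonormal `U` with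
`Uᵀ B_s U = B_r` exists iff the eigenvalues of `B_r` interlace those of `B_s`. -/
theorem stmt2 {m n : ℕ} (hnm : n ≤ m)
    (Bs : Matrix (Fin m) (Fin m) ℝ) (hBs : Bs.PosDef)
    (Br : Matrix (Fin n) (Fin n) ℝ) (hBr : Br.PosDef)
    (lams : Fin m → ℝ) (lamr : Fin n → ℝ)
    (hs : IsSortedEigs Bs lams) (hr : IsSortedEigs Br lamr) :
    (∃ U : Matrix (Fin m) (Fin n) ℝ, Uᵀ * U = 1 ∧ Uᵀ * Bs * U = Br)
      ↔ ∀ i : Fin n,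
          lams ⟨i.1, by have := i.2; omega⟩ ≤ lamr i ∧
          lamr i ≤ lams ⟨i.1 + (m - n), by have := i.2; omega⟩ := by
  obtain ⟨hs, P, hP, hPs⟩ := hs
  obtain ⟨hr, Q, hQ, hQr⟩ := hr
  rw [exists_compression_conj hP hQ hPs hQr]
  constructor
  · rintro ⟨U, hU, hab⟩ i
    have hi := i.2
    constructor
    · refine le_of_compression_of_card_lt hU hab (S := Finset.Iic i)
        (T := Finset.Iio ⟨i, by omega⟩) (by simp) (fun t ht => hs ?_) fun s hs => hr ?_
      · simpa using ht
      · simpa using hs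
    · have hab' : Uᵀ * diagonal (-lams) * U = diagonal (-lamr) := by
        change Uᵀ * diagonal (fun i => -lams i) * U = diagonal fun i => -lamr i
        rw [← diagonal_neg, Matrix.mul_neg, Matrix.neg_mul, hab, diagonal_neg]
      refine neg_le_neg_iff.1 (le_of_compression_of_card_lt hU hab' (S := Finset.Ici i)
        (T := Finset.Ioi ⟨i + (m - n), by omega⟩) (by simp; omega)
        (fun t ht => neg_le_neg (hs ?_)) fun s hs => neg_le_neg (hr ?_))
      · simpa using ht
      · simpa using hs
  · intro h
    obtain ⟨d, rfl⟩ := Nat.exists_eq_add_of_le hnm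
    obtain ⟨U, hU, hab⟩ := exists_compression_of_interlace n d
      (fun i => if hi : i < n + d then lams ⟨i, hi⟩ else 0)
      (fun i => if hi : i < n then lamr ⟨i, hi⟩ else 0)
      (fun i j hij hj => by
        simp only [hj, hij.trans_lt hj, dif_pos]
        exact hs hij)
      (fun i j hij hj => by
        simp only [hj, hij.trans_lt hj, dif_pos]
        exact hr hij)
      (fun i hi => by
        have := h ⟨i, hi⟩
        simpa [hi, show i < n + d by omega] using this)
    exact ⟨U, hU, by simpa using hab⟩
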